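/- Let G be a connected graph of order at least 2 and let v be a vertex of G. Then the extension G{v} of G at v satisfies rad(G{v}) = rad(G) and diam(G{v}) = diam(G). -/

import Mathlib

open SimpleGraph

/-- The eccentricity of a vertex `v`: the maximum distance from `v` to any vertex. -/
noncomputable def eccentricity {V : Type*} [Fintype V] (G : SimpleGraph V) (v : V) : ℕ :=
  Finset.univ.sup fun u => G.dist v u

/-- The radius of a graph: the minimum eccentricity over all vertices. -/
noncomputable def graphRadius {V : Type*} [Fintype V] (G : SimpleGraph V) : ℕ :=
  ⨅ v, eccentricity G v

/-- The diameter of a graph: the maximum eccentricity over all vertices. -/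
noncomputable def graphDiam {V : Type*} [Fintype V] (G : SimpleGraph V) : ℕ :=
  Finset.univ.sup fun v => eccentricity G v

/-- A connected graph is radially maximal if it is not complete and adding
any edge of the complement strictly decreases the radius. -/
def RadiallyMaximal {V : Type*} [Fintype V] (G : SimpleGraph V) : Prop :=
  G.Connected ∧ G ≠ ⊤ ∧ ∀ u v : V, u ≠ v → ¬ G.Adj u v →
    graphRadius (G ⊔ SimpleGraph.edge u v) < graphRadius G

/-- The extension of `G` at `v`: add a new vertex `none` adjacent to `v`
and to every neighbor of `v` in `G`. Old vertices are embedded via `some`. -/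
def extensionAt {V : Type*} (G : SimpleGraph V) (v : V) : SimpleGraph (Option V) :=
  SimpleGraph.fromRel (fun x y => match x, y with
    | some a, some b => G.Adj a b
    | some a, none => a = v ∨ G.Adj a v
    | _, _ => False)

def extProj {V : Type*} (v : V) (x : Option V) : V := x.getD v

lemma ext_adj_some {V : Type*} (G : SimpleGraph V) (v a b : V) :
    (extensionAt G v).Adj (some a) (some b) ↔ G.Adj a b := by
  simp only [extensionAt, SimpleGraph.fromRel_adj]
  constructor
  · rintro ⟨_, h | h⟩
    · exact h
    · exact h.symm
  · intro h
    exact ⟨by simpa using h.ne, Or.inl h⟩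

lemma ext_adj_none {V : Type*} (G : SimpleGraph V) (v a : V) :
    (extensionAt G v).Adj none (some a) ↔ a = v ∨ G.Adj a v := by
  simp [extensionAt, SimpleGraph.fromRel_adj]

lemma ext_proj_adj {V : Type*} (G : SimpleGraph V) (v : V) (x y : Option V)
    (h : (extensionAt G v).Adj x y) :
    extProj v x = extProj v y ∨ G.Adj (extProj v x) (extProj v y) := by
  rcases x with _ | a <;> rcases y with _ | b
  · exact Or.inl rfl
  · rcases (ext_adj_none G v b).1 h with h | h
    · exact Or.inl h.symm
    · exact Or.inr h.symm
  · exact (ext_adj_none G v a).1 h.symm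
  · exact Or.inr ((ext_adj_some G v a b).1 h)

lemma ext_proj_walk {V : Type*} (G : SimpleGraph V) (v : V) {x y : Option V}
    (w : (extensionAt G v).Walk x y) :
    ∃ w' : G.Walk (extProj v x) (extProj v y), w'.length ≤ w.length := by
  induction w with
  | nil => exact ⟨.nil, le_rfl⟩
  | @cons a b c h w ih =>
    obtain ⟨w', hw⟩ := ih
    rcases ext_proj_adj G v a b h with h | h
    · rw [h]
      exact ⟨w', by simp; omega⟩
    · exact ⟨.cons h w', by simpa using hw⟩

def extHom {V : Type*} (G : SimpleGraph V) (v : V) : G →g extensionAt G v where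
  toFun := some
  map_rel' := fun h => (ext_adj_some G v _ _).2 h

lemma ext_conn {V : Type*} (G : SimpleGraph V) (v : V) (hc : G.Connected) :
    (extensionAt G v).Connected := by
  have key : ∀ x, (extensionAt G v).Reachable (some v) x := by
    rintro (_ | a)
    · exact ((ext_adj_none G v v).2 (Or.inl rfl)).symm.reachable
    · exact (hc.preconnected v a).map (extHom G v)
  exact ⟨fun x y => (key x).symm.trans (key y)⟩

lemma ext_dist_ge {V : Type*} (G : SimpleGraph V) (v : V) (hc : G.Connected) (x y : Option V) :
    G.dist (extProj v x) (extProj v y) ≤ (extensionAt G v).dist x y := by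
  obtain ⟨w, hw⟩ := (ext_conn G v hc).exists_walk_length_eq_dist x y
  obtain ⟨w', hw'⟩ := ext_proj_walk G v w
  exact (SimpleGraph.dist_le w').trans (hw'.trans hw.le)

lemma ext_dist_none {V : Type*} (G : SimpleGraph V) (v : V) (hc : G.Connected) (b : V) :
    (extensionAt G v).dist none (some b) ≤ max 1 (G.dist v b) := by
  obtain ⟨w, hw⟩ := hc.exists_walk_length_eq_dist v b
  rw [← hw]
  cases w with
  | nil =>
    exact le_max_of_le_left
      (SimpleGraph.dist_le (Walk.cons ((ext_adj_none G v v).2 (Or.inl rfl)) .nil))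
  | cons h w =>
    refine le_max_of_le_right ?_
    refine (SimpleGraph.dist_le
      (Walk.cons ((ext_adj_none G v _).2 (Or.inr h.symm)) (w.map (extHom G v)))).trans ?_
    change (w.map (extHom G v)).length + 1 ≤ w.length + 1
    rw [Walk.length_map]

lemma ext_dist_le {V : Type*} (G : SimpleGraph V) (v : V) (hc : G.Connected) (x y : Option V) :
    (extensionAt G v).dist x y ≤ max 1 (G.dist (extProj v x) (extProj v y)) := by
  rcases x with _ | a <;> rcases y with _ | b
  · simp
  · exact ext_dist_none G v hc b
  · rw [SimpleGraph.dist_comm, SimpleGraph.dist_comm (G := G)]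
    exact ext_dist_none G v hc a
  · refine le_max_of_le_right ?_
    obtain ⟨w, hw⟩ := hc.exists_walk_length_eq_dist a b
    refine (SimpleGraph.dist_le (w.map (extHom G v))).trans ?_
    simp [hw, extProj]

lemma ext_ecc {V : Type*} [Fintype V] (G : SimpleGraph V) (v : V) (hc : G.Connected)
    (hcard : 2 ≤ Fintype.card V) (x : Option V) :
    eccentricity (extensionAt G v) x = eccentricity G (extProj v x) := by
  have hle : ∀ a b, G.dist a b ≤ eccentricity G a := fun a b =>
    Finset.le_sup (f := fun u => G.dist a u) (Finset.mem_univ b)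
  apply le_antisymm
  · refine Finset.sup_le fun y _ => (ext_dist_le G v hc x y).trans (max_le ?_ (hle _ _))
    haveI : Nontrivial V := Fintype.one_lt_card_iff_nontrivial.1 hcard
    obtain ⟨b, hb⟩ := exists_ne (extProj v x)
    exact (hc.pos_dist_of_ne hb.symm).trans_le (hle _ b)
  · refine Finset.sup_le fun b _ => (ext_dist_ge G v hc x (some b)).trans ?_
    exact Finset.le_sup (f := fun u => (extensionAt G v).dist x u) (Finset.mem_univ (some b))

/-- The extension of a connected graph of order at least 2 at a vertex has the
same radius and the same diameter as the original graph. -/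
theorem stmt_6 {V : Type*} [Fintype V] (G : SimpleGraph V) (v : V)
    (hconn : G.Connected) (hcard : 2 ≤ Fintype.card V) :
    graphRadius (extensionAt G v) = graphRadius G ∧
      graphDiam (extensionAt G v) = graphDiam G := by
  constructor
  · unfold graphRadius
    simp only [ext_ecc G v hconn hcard]
    have hs : Function.Surjective (extProj v) := fun a => ⟨some a, rfl⟩
    exact hs.iInf_comp (eccentricity G)
  · unfold graphDiam
    apply le_antisymm
    · refine Finset.sup_le fun x _ => ?_
      rw [ext_ecc G v hconn hcard]
      exact Finset.le_sup (f := fun u => eccentricity G u) (Finset.mem_univ _)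
    · refine Finset.sup_le fun a _ => ?_
      have := ext_ecc G v hconn hcard (some a)
      refine this.symm.le.trans ?_
      exact Finset.le_sup (f := fun u => eccentricity (extensionAt G v) u) (Finset.mem_univ _)
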